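/- Let n ≥ 1, let B ⊆ Fin n, let a : Fin n → Fin n → ℝ be a measurement matrix, and let f : Fin n → ℝ. If v minimizes I over { u : Fin n → ℝ : u_i = f_i for all i ∈ B }, then v is a voltage potential for the Dirichlet data (f, a); that is, there exists J : Fin n → Fin n → ℝ with J_{ij} = −J_{ji} for all i,j, ∑_j J_{ij} = 0 for all i ∉ B, J_{ij}·(v_i − v_j) ≥ 0 for all i,j, and |J_{ij}| = a_{ij} for all i,j with v_i ≠ v_j. (Every minimizer of the Dirichlet least gradient problem is a voltage potential.) -/

import Mathlib

/-- Weighted ℓ¹ energy `I(u) = (1/2) ∑_{i,j} a_{ij} |u_i - u_j|`. -/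
noncomputable def lgEnergy {n : ℕ} (a : Fin n → Fin n → ℝ) (u : Fin n → ℝ) : ℝ :=
  (1 / 2) * ∑ i, ∑ j, a i j * |u i - u j|

open Classical in
theorem aux_class_sum (n : ℕ) (a : Fin n → Fin n → ℝ)
    (hasymm : ∀ i j, a i j = a j i) (v : Fin n → ℝ) (c : ℝ)
    (hmin : ∀ t : ℝ, lgEnergy a v ≤ lgEnergy a (fun i => v i + if v i = c then t else 0)) :
    ∑ i, (if v i = c then ∑ j, a i j * Real.sign (v i - v j) else 0) = 0 := by
  have h1 : ∀ i j, ∀ᶠ t in nhdsWithin (0:ℝ) (Set.Ioi 0), v i ≠ v j → t ≤ |v i - v j| := by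
    intro i j
    by_cases h : v i = v j
    · simp [h]
    · have : 0 < |v i - v j| := abs_pos.mpr (sub_ne_zero.mpr h)
      filter_upwards [Ioo_mem_nhdsGT this] with t ht _
      exact ht.2.le
  have h2 := Filter.eventually_all.mpr fun i => Filter.eventually_all.mpr (h1 i)
  obtain ⟨d, hd, hd0⟩ := (h2.and self_mem_nhdsWithin).exists
  have hd0 : 0 < d := hd0
  set F : Fin n → ℝ := fun i => ∑ j, a i j * Real.sign (v i - v j) with hF
  set e : Fin n → ℝ := fun i => if v i = c then 1 else 0 with he
  have key : ∀ t : ℝ, |t| ≤ d →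
      lgEnergy a (fun i => v i + if v i = c then t else 0)
        = lgEnergy a v + t * ∑ i, e i * F i := by
    intro t ht
    have hp : ∀ i j, a i j * |(v i + if v i = c then t else 0) - (v j + if v j = c then t else 0)|
        = a i j * |v i - v j| + t * (e i * (a i j * Real.sign (v i - v j)))
          + t * (e j * (a j i * Real.sign (v j - v i))) := by
      intro i j
      have hds := hd i j
      have ht' := abs_le.mp ht
      rw [hasymm j i]
      rcases lt_trichotomy (v i) (v j) with h | h | h
      · have h3 := hds h.ne
        rw [abs_of_neg (sub_neg.mpr h)] at h3
        rw [Real.sign_of_neg (sub_neg.mpr h), Real.sign_of_pos (sub_pos.mpr h),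
          abs_of_neg (sub_neg.mpr h), abs_of_nonpos]
        · simp only [he]; split_ifs <;> ring
        · split_ifs <;> linarith
      · simp [h]
      · have h3 := hds h.ne'
        rw [abs_of_pos (sub_pos.mpr h)] at h3
        rw [Real.sign_of_neg (sub_neg.mpr h), Real.sign_of_pos (sub_pos.mpr h),
          abs_of_pos (sub_pos.mpr h), abs_of_nonneg]
        · simp only [he]; split_ifs <;> ring
        · split_ifs <;> linarith
    have hs : ∑ i, ∑ j, t * (e j * (a j i * Real.sign (v j - v i))) = t * ∑ i, e i * F i := by
      rw [Finset.sum_comm]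
      simp only [hF, Finset.mul_sum]
    have hs' : ∑ i, ∑ j, t * (e i * (a i j * Real.sign (v i - v j))) = t * ∑ i, e i * F i := by
      simp only [hF, Finset.mul_sum]
    unfold lgEnergy
    simp only [hp, Finset.sum_add_distrib]
    rw [hs, hs']; ring
  have k1 := hmin d
  rw [key d (abs_of_pos hd0).le] at k1
  have k2 := hmin (-d)
  rw [key (-d) (by rw [abs_neg, abs_of_pos hd0])] at k2
  have : ∑ i, e i * F i = 0 := by
    apply le_antisymm
    · by_contra! h; nlinarith
    · by_contra! h; nlinarith
  refine Eq.trans ?_ this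
  apply Finset.sum_congr rfl
  intro i _
  simp only [he, hF]; split_ifs <;> simp

/-- Every minimizer of the Dirichlet least gradient problem is a voltage potential. -/
theorem dirichlet_minimizer_is_voltage_potential
    (n : ℕ) (hn : 1 ≤ n) (B : Finset (Fin n))
    (a : Fin n → Fin n → ℝ)
    (hasymm : ∀ i j, a i j = a j i) (hanonneg : ∀ i j, 0 ≤ a i j)
    (hadiag : ∀ i, a i i = 0)
    (f : Fin n → ℝ) (v : Fin n → ℝ)
    (hvB : ∀ i ∈ B, v i = f i)
    (hvmin : ∀ u : Fin n → ℝ, (∀ i ∈ B, u i = f i) → lgEnergy a v ≤ lgEnergy a u) :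
    ∃ J : Fin n → Fin n → ℝ,
      (∀ i j, J i j = -J j i) ∧
      (∀ i, i ∉ B → ∑ j, J i j = 0) ∧
      (∀ i j, 0 ≤ J i j * (v i - v j)) ∧
      (∀ i j, v i ≠ v j → |J i j| = a i j) := by
  classical
  set F : Fin n → ℝ := fun i => ∑ j, a i j * Real.sign (v i - v j) with hF
  have hg : ∀ c : ℝ, ∃ k : Fin n, (∀ i, v i = c → v k = c) ∧ (∀ i ∈ B, v i = c → k ∈ B) := by
    intro c
    by_cases h : ∃ i ∈ B, v i = c
    · obtain ⟨i, hi, hc⟩ := h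
      exact ⟨i, fun _ _ => hc, fun _ _ _ => hi⟩
    · by_cases h' : ∃ i, v i = c
      · obtain ⟨i, hc⟩ := h'
        exact ⟨i, fun _ _ => hc, fun j hj hjc => absurd ⟨j, hj, hjc⟩ h⟩
      · exact ⟨⟨0, hn⟩, fun j hj => absurd ⟨j, hj⟩ h', fun j hj hjc => absurd ⟨j, hj, hjc⟩ h⟩
  choose g hg1 hg2 using hg
  have hvg : ∀ i, v (g (v i)) = v i := fun i => hg1 _ i rfl
  set T : Fin n → Fin n → ℝ := fun i j =>
    (if j = g (v i) then -F i else 0) + (if i = g (v j) then F j else 0) with hT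
  have hT0 : ∀ i j, v i ≠ v j → T i j = 0 := by
    intro i j h
    have h1 : j ≠ g (v i) := fun e => h (by rw [e, hvg])
    have h2 : i ≠ g (v j) := fun e => h (by rw [e, hvg])
    simp [hT, h1, h2]
  refine ⟨fun i j => a i j * Real.sign (v i - v j) + T i j, ?_, ?_, ?_, ?_⟩
  · intro i j
    have : Real.sign (v i - v j) = - Real.sign (v j - v i) := by
      rw [← Real.sign_neg, neg_sub]
    simp only [hT]
    rw [this, hasymm i j]
    split_ifs <;> ring
  · intro i hi
    have e1 : ∑ j, T i j = -F i + ∑ j, (if i = g (v j) then F j else 0) := by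
      simp only [hT, Finset.sum_add_distrib]
      simp
    have e2 : ∑ j, (if i = g (v j) then F j else 0) = 0 := by
      by_cases h : i = g (v i)
      · have hB : ∀ j ∈ B, v j ≠ v i := fun j hj hjc => hi (h ▸ hg2 (v i) j hj hjc)
        have := aux_class_sum n a hasymm v (v i) (by
          intro t
          apply hvmin
          intro j hj
          rw [if_neg (hB j hj), add_zero, hvB j hj])
        refine Eq.trans ?_ this
        apply Finset.sum_congr rfl
        intro j _
        have : i = g (v j) ↔ v j = v i := by
          constructor
          · intro e; rw [e, hvg]
          · intro e; rw [e]; exact h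
        simp only [this, hF]
      · apply Finset.sum_eq_zero
        intro j _
        rw [if_neg]
        intro e
        apply h
        have : v i = v j := by rw [e, hvg]
        rw [this]; exact e
    rw [Finset.sum_add_distrib, e1, e2]
    simp only [hF]; ring
  · intro i j
    by_cases h : v i = v j
    · simp [h]
    · simp only [hT0 i j h, add_zero]
      rcases lt_or_gt_of_ne h with h | h
      · rw [Real.sign_of_neg (sub_neg.mpr h)]; nlinarith [hanonneg i j]
      · rw [Real.sign_of_pos (sub_pos.mpr h)]; nlinarith [hanonneg i j]
  · intro i j h
    simp only [hT0 i j h, add_zero]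
    rcases lt_or_gt_of_ne h with h | h
    · rw [Real.sign_of_neg (sub_neg.mpr h)]; simp [abs_of_nonneg (hanonneg i j)]
    · rw [Real.sign_of_pos (sub_pos.mpr h)]; simp [abs_of_nonneg (hanonneg i j)]
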